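/- Let A be a real symmetric positive definite n×n matrix and let q be a real polynomial such that |1 − λ q(λ)| < 1 for every eigenvalue λ of A. Then R = q(A) is symmetric positive definite, and the symmetrized smoother R̄ = 2R − R A R is also symmetric positive definite. -/

import Mathlib

open Matrix Polynomial

theorem Matrix.aeval_diagonal {ι R : Type*} [Fintype ι] [DecidableEq ι] [CommRing R]
    (d : ι → R) (p : R[X]) :
    aeval (diagonal d) p = diagonal fun i => p.eval (d i) := by
  rw [← diagonalAlgHom_apply R, aeval_algHom_apply, diagonalAlgHom_apply]
  simp [aeval_pi, coe_aeval_eq_eval]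

theorem Matrix.IsHermitian.posDef_aeval {ι : Type*} [Fintype ι] [DecidableEq ι]
    {A : Matrix ι ι ℝ} (hA : A.IsHermitian) {p : ℝ[X]}
    (hp : ∀ μ ∈ spectrum ℝ A, 0 < p.eval μ) : (aeval A p).PosDef := by
  have key : aeval A p = Unitary.conjStarAlgAut ℝ _ hA.eigenvectorUnitary
      (diagonal fun i => p.eval (hA.eigenvalues i)) := by
    conv_lhs => rw [hA.spectral_theorem]
    rw [← Matrix.aeval_diagonal]
    exact aeval_algHom_apply
      (Unitary.conjStarAlgAut ℝ _ hA.eigenvectorUnitary).toAlgEquiv.toAlgHom _ _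
  rw [key, Unitary.conjStarAlgAut_apply,
    IsUnit.posDef_star_right_conjugate_iff (Unitary.isUnit_coe)]
  exact .diagonal fun i => hp _ (hA.eigenvalues_mem_spectrum_real i)

/-- if `A` is symmetric positive definite and `|1 - λ q(λ)| < 1` for
every eigenvalue `λ` of `A`, then `R = q(A)` is symmetric positive definite, and
the symmetrized smoother `R̄ = 2R - RAR` is also symmetric positive definite. -/
theorem smoother_and_symmetrization_posdef {n : ℕ} (A : Matrix (Fin n) (Fin n) ℝ)
    (hA : A.PosDef) (q : Polynomial ℝ)
    (h : ∀ μ ∈ spectrum ℝ A, |1 - μ * q.eval μ| < 1) :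
    ((aeval A) q).PosDef ∧
    ((2 : ℝ) • (aeval A) q - (aeval A) q * A * (aeval A) q).PosDef := by
  have spectrum_pos : ∀ μ ∈ spectrum ℝ A, 0 < μ := by
    rw [hA.isHermitian.spectrum_real_eq_range_eigenvalues]
    rintro _ ⟨i, rfl⟩
    exact hA.eigenvalues_pos i
  have q_pos : ∀ μ ∈ spectrum ℝ A, 0 < q.eval μ := fun μ hμ =>
    pos_of_mul_pos_right (by linarith [(abs_lt.mp (h μ hμ)).2]) (spectrum_pos μ hμ).le
  refine ⟨hA.isHermitian.posDef_aeval q_pos, ?_⟩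
  have symm_eq : (2 : ℝ) • aeval A q - aeval A q * A * aeval A q =
      aeval A ((2 : ℝ) • q - q * X * q) := by simp
  rw [symm_eq]
  refine hA.isHermitian.posDef_aeval fun μ hμ => ?_
  have factor : ((2 : ℝ) • q - q * X * q).eval μ = q.eval μ * (2 - μ * q.eval μ) := by
    simp
    ring
  rw [factor]
  exact mul_pos (q_pos μ hμ) (by linarith [(abs_lt.mp (h μ hμ)).1])
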